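/- Let n > 6 and let B′ be a saturated blocker of size n−1 of the convex n-gon such that there is no vertex w with {w−1,w+1} ∉ B′ and deg_{B′}(w) = 2. If v is a vertex with deg_{B′}(v) = 1 and {v−1,v+1} ∉ B′, then B′∖{v} is a saturated blocker with exactly n−2 edges of the (n−1)-gon C∖{v}. -/

import Mathlib

open Finset

namespace ConvexBlocker

/-- `c` lies strictly inside the (positively oriented) open arc from `a` to `b`. -/
def Btw (n : ℕ) (a c b : ZMod n) : Prop :=
  0 < (c - a).val ∧ (c - a).val < (b - a).val

/-- Two edges of the convex `n`-gon cross: their endpoints are four pairwise distinct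
vertices which interleave in the cyclic order. -/
def Cross (n : ℕ) (e f : Sym2 (ZMod n)) : Prop :=
  ∃ a b c d : ZMod n, e = s(a, b) ∧ f = s(c, d) ∧
    0 < (c - a).val ∧ (c - a).val < (b - a).val ∧ (b - a).val < (d - a).val

/-- `e` is an edge (an unordered pair of distinct vertices) of the `n`-gon. -/
def IsEdge (n : ℕ) (e : Sym2 (ZMod n)) : Prop :=
  ∃ a b : ZMod n, e = s(a, b) ∧ a ≠ b

/-- `e` is a diagonal of the convex `n`-gon: an edge of order at least 2, i.e. both open
arcs between its endpoints are nonempty. -/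
def IsDiagonal (n : ℕ) (e : Sym2 (ZMod n)) : Prop :=
  ∃ a b : ZMod n, e = s(a, b) ∧ a ≠ b ∧ (∃ c, Btw n a c b) ∧ (∃ d, Btw n b d a)

/-- A triangulation of the convex `n`-gon: an inclusion-maximal set of pairwise
non-crossing diagonals. -/
def IsTriangulation (n : ℕ) (T : Finset (Sym2 (ZMod n))) : Prop :=
  (∀ e ∈ T, IsDiagonal n e) ∧
  (∀ e ∈ T, ∀ f ∈ T, ¬ Cross n e f) ∧
  (∀ e, IsDiagonal n e → e ∉ T → ∃ f ∈ T, Cross n e f)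

/-- A blocker of the convex `n`-gon: a set of edges meeting every triangulation. -/
def IsBlocker (n : ℕ) (B : Finset (Sym2 (ZMod n))) : Prop :=
  (∀ e ∈ B, IsEdge n e) ∧
  ∀ T : Finset (Sym2 (ZMod n)), IsTriangulation n T → (B ∩ T).Nonempty

/-- A saturated blocker of the convex `n`-gon. -/
def IsSaturatedBlocker (n : ℕ) (B : Finset (Sym2 (ZMod n))) : Prop :=
  IsBlocker n B ∧ ∀ e ∈ B, ¬ IsBlocker n (B.erase e)

/-- `e` is an edge of the sub-polygon on the vertex set `S`. -/
def IsEdgeOn (n : ℕ) (S : Finset (ZMod n)) (e : Sym2 (ZMod n)) : Prop :=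
  ∃ a b : ZMod n, e = s(a, b) ∧ a ∈ S ∧ b ∈ S ∧ a ≠ b

/-- `e` is a diagonal of the sub-polygon on `S` (with the inherited cyclic order):
its endpoints are distinct members of `S` which are not cyclically consecutive in `S`. -/
def IsDiagonalOn (n : ℕ) (S : Finset (ZMod n)) (e : Sym2 (ZMod n)) : Prop :=
  ∃ a b : ZMod n, e = s(a, b) ∧ a ∈ S ∧ b ∈ S ∧ a ≠ b ∧
    (∃ c ∈ S, Btw n a c b) ∧ (∃ d ∈ S, Btw n b d a)

/-- A triangulation of the sub-polygon on `S`. -/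
def IsTriangulationOn (n : ℕ) (S : Finset (ZMod n)) (T : Finset (Sym2 (ZMod n))) : Prop :=
  (∀ e ∈ T, IsDiagonalOn n S e) ∧
  (∀ e ∈ T, ∀ f ∈ T, ¬ Cross n e f) ∧
  (∀ e, IsDiagonalOn n S e → e ∉ T → ∃ f ∈ T, Cross n e f)

/-- A blocker of the sub-polygon on `S`. -/
def IsBlockerOn (n : ℕ) (S : Finset (ZMod n)) (B : Finset (Sym2 (ZMod n))) : Prop :=
  (∀ e ∈ B, IsEdgeOn n S e) ∧
  ∀ T : Finset (Sym2 (ZMod n)), IsTriangulationOn n S T → (B ∩ T).Nonempty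

/-- A saturated blocker of the sub-polygon on `S`. -/
def IsSaturatedBlockerOn (n : ℕ) (S : Finset (ZMod n)) (B : Finset (Sym2 (ZMod n))) : Prop :=
  IsBlockerOn n S B ∧ ∀ e ∈ B, ¬ IsBlockerOn n S (B.erase e)

/-- The degree of the vertex `v` in the set of edges `B`. -/
noncomputable def degB (n : ℕ) (B : Finset (Sym2 (ZMod n))) (v : ZMod n) : ℕ :=
  (B.filter (fun e => v ∈ e)).card

/-- `Free P a b`: the polygon on the consecutive vertices `a, a + 1, …, b` has a triangulation
which, together with its base edge `(a, b)` when `a + 2 ≤ b`, avoids `P`. -/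
inductive Free (P : Finset (ℕ × ℕ)) : ℕ → ℕ → Prop
  | side (a : ℕ) : Free P a (a + 1)
  | tri {a w b : ℕ} : Free P a w → Free P w b → (a, b) ∉ P → Free P a b

namespace Free

variable {P Q : Finset (ℕ × ℕ)} {a b c j k w y z : ℕ}

theorem lt (h : Free P a b) : a < b := by
  induction h with
  | side => omega
  | tri _ _ _ h₁ h₂ => omega

theorem notMem (h : Free P a b) (hab : a + 2 ≤ b) : (a, b) ∉ P := by
  cases h with
  | side => omega
  | tri _ _ h => exact h

theorem mono (h : Free P a b) (hPQ : ∀ c d, a ≤ c → d ≤ b → (c, d) ∈ Q → (c, d) ∈ P) :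
    Free Q a b := by
  induction h with
  | side a => exact side a
  | tri h₁ h₂ h ih₁ ih₂ =>
    have := h₁.lt
    have := h₂.lt
    exact tri (ih₁ fun c d hc hd => hPQ c d hc (by omega))
      (ih₂ fun c d hc hd => hPQ c d (by omega) hd) fun hm => h (hPQ _ _ le_rfl le_rfl hm)

/-- A free interval may be extended to the left by a fan at its right endpoint. -/
theorem extend_left (h : Free P k z) (hak : a ≤ k)
    (hfan : ∀ c, a ≤ c → c < k → (c, z) ∉ P) : Free P a z := by
  induction hak using Nat.decreasingInduction with
  | self => exact h
  | of_succ c hc ih =>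
    exact tri (side c) (ih fun d hd => hfan d (by omega)) (hfan c le_rfl hc)

theorem of_fan (haz : a < z) (hfan : ∀ c, a ≤ c → c + 2 ≤ z → (c, z) ∉ P) : Free P a z := by
  obtain ⟨k, rfl⟩ : ∃ k, z = k + 1 := ⟨z - 1, by omega⟩
  exact (side k).extend_left (by omega) fun c hc hk => hfan c hc (by omega)

theorem exists_mem_of_not (h : ¬ Free P a z) (haz : a < z) :
    ∃ c, a ≤ c ∧ c + 2 ≤ z ∧ (c, z) ∈ P := by
  by_contra! hc
  exact h (of_fan haz hc)

/-- If the right endpoint `z` carries a single edge of `P`, to `j`, then the interval is free iff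
some free interval ending before `z` jumps over `j`. -/
theorem iff_of_unique (haj : a < j) (hjz : j + 2 ≤ z) (hmem : (j, z) ∈ P)
    (huniq : ∀ c, (c, z) ∈ P → c = j) :
    Free P a z ↔ ∃ c d, a ≤ c ∧ c < j ∧ j < d ∧ d < z ∧ Free P c d := by
  constructor
  · intro h
    generalize hz : z = z' at h
    induction h with
    | side => omega
    | @tri a w b h₁ h₂ h _ ih₂ =>
      subst hz
      have := h₁.lt
      have := h₂.lt
      rcases lt_trichotomy w j with hw | rfl | hw
      · obtain ⟨c, d, hc, h'⟩ := ih₂ hw rfl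
        exact ⟨c, d, by omega, h'⟩
      · exact absurd hmem (h₂.notMem hjz)
      · exact ⟨a, w, le_rfl, haj, hw, by omega, h₁⟩
  · rintro ⟨c, d, hac, hcj, hjd, hdz, h⟩
    have hn : ∀ c, c ≠ j → (c, z) ∉ P := fun c hc hm => hc (huniq c hm)
    have hd : Free P d z := of_fan hdz fun e he _ => hn e (by omega)
    exact (tri h hd (hn c (by omega))).extend_left hac fun e _ he => hn e (by omega)

/-- Intervals around `x` are all blocked iff the only obstructed way of splitting them at `x` is. -/
theorem forall_not_iff {x t : ℕ} :
    (∀ c d, c < x → x < d → d < t → ¬ Free P c d) ↔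
      ∀ c d, c < x → x < d → d < t → Free P c x → Free P x d → (c, d) ∈ P := by
  constructor
  · intro h c d hc hd ht h₁ h₂
    by_contra hm
    exact h c d hc hd ht (tri h₁ h₂ hm)
  · intro h c d hc hd ht hf
    induction hf with
    | side => omega
    | @tri a w b h₁ h₂ hm ih₁ ih₂ =>
      have := h₁.lt
      have := h₂.lt
      rcases lt_trichotomy w x with hw | rfl | hw
      · exact ih₂ hw hd ht
      · exact hm (h a b hc hd ht h₁ h₂)
      · exact ih₁ hc hw (by omega)

/-- A vertex `z` with blocked interval `[0, z]` has an edge downwards avoiding a given vertex `w`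
that is not covered. -/
theorem exists_mem_ne_of_not (hw : 1 ≤ w) (hcov : (w - 1, w + 1) ∉ P) (hz : 0 < z) (hzw : z ≠ w)
    (h : ¬ Free P 0 z) : ∃ c, c ≠ w ∧ (c, z) ∈ P := by
  by_contra! hc
  apply h
  rcases lt_or_gt_of_ne hzw with hlt | hgt
  · exact of_fan hz fun c _ h' => hc c (by omega)
  · have h₀ : Free P (w - 1) (w + 1) := by
      have := side (P := P) (w - 1)
      rw [show w - 1 + 1 = w by omega] at this
      exact tri this (side w) hcov
    have h₁ : Free P (w - 1) z := by
      rcases eq_or_lt_of_le (show w + 1 ≤ z by omega) with rfl | hlt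
      · exact h₀
      · exact tri h₀ (of_fan hlt fun c hc' _ => hc c (by omega)) (hc _ (by omega))
    exact h₁.extend_left (Nat.zero_le _) fun c _ hc' => hc c (by omega)

end Free

open Classical in
/-- The vertices `z ∈ [1, p]` whose interval `[0, z]` is free. -/
noncomputable def freeEnds (P : Finset (ℕ × ℕ)) (p : ℕ) : Finset ℕ :=
  (Icc 1 p).filter fun z => Free P 0 z

open Classical in
/-- The vertices `z ∈ [1, p]` whose interval `[0, z]` is blocked. -/
noncomputable def blockedEnds (P : Finset (ℕ × ℕ)) (p : ℕ) : Finset ℕ :=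
  (Icc 1 p).filter fun z => ¬ Free P 0 z

/-- The number of pairs in `P` containing `w`. -/
def pairDeg (P : Finset (ℕ × ℕ)) (w : ℕ) : ℕ := #{e ∈ P | e.1 = w ∨ e.2 = w}

variable {P Q : Finset (ℕ × ℕ)} {p q w : ℕ}

theorem mem_freeEnds {z : ℕ} : z ∈ freeEnds P p ↔ (1 ≤ z ∧ z ≤ p) ∧ Free P 0 z := by
  simp [freeEnds]

theorem mem_blockedEnds {z : ℕ} : z ∈ blockedEnds P p ↔ (1 ≤ z ∧ z ≤ p) ∧ ¬ Free P 0 z := by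
  simp [blockedEnds]

theorem card_freeEnds_add_card_blockedEnds : #(freeEnds P p) + #(blockedEnds P p) = p := by
  classical
  rw [freeEnds, blockedEnds, card_filter_add_card_filter_not]
  simp

theorem one_mem_freeEnds (hp : 1 ≤ p) : 1 ∈ freeEnds P p :=
  mem_freeEnds.2 ⟨⟨le_rfl, hp⟩, Free.side 0⟩

theorem blockedEnds_subset_image : blockedEnds P p ⊆ P.image Prod.snd := by
  intro z hz
  obtain ⟨⟨h1, -⟩, hz⟩ := mem_blockedEnds.1 hz
  obtain ⟨c, -, -, hc⟩ := Free.exists_mem_of_not hz h1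
  exact mem_image_of_mem Prod.snd hc

theorem card_blockedEnds_le : #(blockedEnds P p) ≤ #P :=
  (card_le_card blockedEnds_subset_image).trans card_image_le

theorem pairDeg_add_card_erase_le (hw1 : 1 ≤ w) (hcov : (w - 1, w + 1) ∉ P) :
    pairDeg P w + #((blockedEnds P p).erase w) ≤ #P := by
  rw [pairDeg, ← card_filter_add_card_filter_not (s := P) fun e => e.1 = w ∨ e.2 = w]
  gcongr
  refine (card_le_card ?_).trans (card_image_le (f := Prod.snd))
  intro z hz
  obtain ⟨hne, hz⟩ := mem_erase.1 hz
  obtain ⟨⟨h1, -⟩, hz⟩ := mem_blockedEnds.1 hz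
  obtain ⟨c, hc, hm⟩ := Free.exists_mem_ne_of_not hw1 hcov h1 hne hz
  exact mem_image.2 ⟨(c, z), mem_filter.2 ⟨hm, by simp [hc, hne]⟩, rfl⟩

/-- In the tight case no free end beyond the first one is covered. -/
theorem notMem_of_card_eq (hcard : #P = #(blockedEnds P p)) (hw : 2 ≤ w) (hfree : Free P 0 w) :
    (w - 1, w + 1) ∉ P := by
  intro hm
  have himg : P.image Prod.snd = blockedEnds P p :=
    (eq_of_subset_of_card_le blockedEnds_subset_image (card_image_le.trans hcard.le)).symm
  have hinj : Set.InjOn Prod.snd (P : Set (ℕ × ℕ)) := by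
    rw [← card_image_iff, himg, hcard]
  have hb : ¬ Free P 0 (w + 1) :=
    (mem_blockedEnds.1 (himg ▸ mem_image_of_mem Prod.snd hm)).2
  apply hb
  rw [Free.iff_of_unique (j := w - 1) (by omega) (by omega) hm
    fun c hc => congrArg Prod.fst (hinj hc hm rfl)]
  exact ⟨0, w, le_rfl, by omega, by omega, by omega, hfree⟩

/-- If a single edge `(k, y)` ending at a free end is superfluous for the count, it can be
erased. -/
theorem Free.of_erase_of_free {k y a z : ℕ} (hP : ∀ a b, (a, b) ∈ P → a + 2 ≤ b)
    (hk : (k, y) ∈ P) (hy : Free P 0 y)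
    (huniq : ∀ c c' z, z ≠ y → (c, z) ∈ P → (c', z) ∈ P → c = c')
    (hblocked : ∀ c z, z ≠ y → (c, z) ∈ P → ¬ Free P 0 z)
    (hyz : y < z) (h : Free (P.erase (k, y)) a z) : Free P a z := by
  induction z using Nat.strong_induction_on generalizing a with
  | _ z ih =>
    by_contra hn
    obtain ⟨j, haj, hjz, hj⟩ := Free.exists_mem_of_not hn h.lt
    have hj' : (j, z) ∈ P.erase (k, y) := mem_erase.2 ⟨by simp; omega, hj⟩
    have hju : ∀ c, (c, z) ∈ P → c = j := fun c hc => huniq c j z (by omega) hc hj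
    rcases haj.eq_or_lt with rfl | haj
    · exact h.notMem hjz hj'
    have hz : ∀ c d, c < j → j < d → d < z → ¬ Free P c d := by
      intro c d hc hd hdz hf
      refine hblocked j z (by omega) hj
        ((Free.iff_of_unique (by omega) hjz hj hju).2 ⟨c, d, by omega, hc, hd, hdz, hf⟩)
    have hyk := hP k y hk
    rcases lt_trichotomy j y with hjy | rfl | hjy
    · exact hz 0 y (by omega) hjy hyz hy
    · have h0 : (0, j + 1) ∈ P := by
        by_contra hc
        exact hz 0 (j + 1) (by omega) (by omega) (by omega) (.tri hy (.side j) hc)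
      have h1 : (j - 1, j + 1) ∈ P := by
        by_contra hc
        refine hz (j - 1) (j + 1) (by omega) (by omega) (by omega) (.tri ?_ (.side j) hc)
        convert Free.side (P := P) (j - 1)
        omega
      have := huniq _ _ _ (by omega) h0 h1
      omega
    · rw [Free.iff_of_unique haj hjz hj' fun c hc => hju c (mem_of_mem_erase hc)] at h
      obtain ⟨c, d, -, hc, hd, hdz, hf⟩ := h
      exact hz c d hc hd hdz (ih d hdz (by omega) hf)

/-- A vertex `y` with two downward edges, all the others having at most one: the longer of the
two edges can be erased. -/
theorem Free.of_erase_of_two {i y a z : ℕ} (hi : (i, y) ∈ P) (hiy : i + 3 ≤ y)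
    (huniq : ∀ c c' z, z ≠ y → (c, z) ∈ P → (c', z) ∈ P → c = c')
    (hblocked : ∀ c z, (c, z) ∈ P → ¬ Free P 0 z)
    (hy : (y - 1, y + 1) ∈ P) (hy' : (y - 3, y - 1) ∈ P)
    (h : Free (P.erase (i, y)) a z) : Free P a z := by
  have h₁ : ∀ c, c < y - 1 → ¬ Free P c y := by
    intro c hc hf
    refine hblocked _ _ hy ((Free.iff_of_unique (j := y - 1) (by omega) (by omega) hy
      fun c hc => huniq _ _ _ (by omega) hc hy).2
        ⟨c, y, by omega, by omega, by omega, by omega, hf⟩)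
  have hu : ∀ c, (c, y - 1) ∈ P → c = y - 3 := fun c hc => huniq _ _ _ (by omega) hc hy'
  have h₂ : ¬ Free P i (y - 1) := by
    intro hf
    rcases eq_or_lt_of_le (show i ≤ y - 3 by omega) with rfl | hlt
    · exact hf.notMem (by omega) hy'
    · obtain ⟨c, d, hc⟩ := (Free.iff_of_unique hlt (by omega) hy' hu).1 hf
      exact hblocked _ _ hy' ((Free.iff_of_unique (by omega) (by omega) hy' hu).2
        ⟨c, d, by omega, hc.2⟩)
  induction h with
  | side a => exact .side a
  | @tri a w b _ _ hm h₁' h₂' =>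
    refine .tri h₁' h₂' fun hm' => ?_
    by_cases he : (a, b) = (i, y)
    · obtain ⟨rfl, rfl⟩ := Prod.mk.inj he
      have := h₂'.lt
      by_cases hw : w < b - 1
      · exact h₁ w hw h₂'
      · rw [show w = b - 1 by omega] at h₁'
        exact h₂ h₁'
    · exact hm (mem_erase.2 ⟨he, hm'⟩)

/-- One side of the configuration cannot have exactly one superfluous edge. -/
theorem card_ne_succ (hP : ∀ a b, (a, b) ∈ P → a + 2 ≤ b ∧ b ≤ p)
    (hmin : ∀ e ∈ P, ∃ z, 1 ≤ z ∧ z ≤ p ∧ ¬ Free P 0 z ∧ Free (P.erase e) 0 z)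
    (hcov : ∀ w, 1 ≤ w → w ≤ p → 2 ≤ pairDeg P w ∨ (Free P 0 w ∧ 1 ≤ pairDeg P w) →
      (w - 1, w + 1) ∈ P) :
    #P ≠ #(blockedEnds P p) + 1 := by
  intro hcard
  have hP' : ∀ a b, (a, b) ∈ P → a + 2 ≤ b := fun a b h => (hP a b h).1
  obtain ⟨S, hSP, hSimg, hSinj⟩ :
      ∃ S ⊆ P, S.image Prod.snd = blockedEnds P p ∧ Set.InjOn Prod.snd (S : Set (ℕ × ℕ)) := by
    have hex : ∀ z, ∃ c, z ∈ blockedEnds P p → (c, z) ∈ P := by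
      intro z
      by_cases hz : z ∈ blockedEnds P p
      · obtain ⟨⟨c, z⟩, hc, rfl⟩ := mem_image.1 (blockedEnds_subset_image hz)
        exact ⟨c, fun _ => hc⟩
      · exact ⟨0, fun h => absurd h hz⟩
    choose g hg using hex
    refine ⟨(blockedEnds P p).image fun z => (g z, z), ?_, ?_, ?_⟩
    · exact image_subset_iff.2 hg
    · simp [image_image, Function.comp_def]
    · simp +contextual [Set.InjOn]
  have hScard : #S = #(blockedEnds P p) := by rw [← hSimg, card_image_of_injOn hSinj]
  obtain ⟨⟨k, y⟩, hk⟩ : ∃ e, P \ S = {e} := by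
    rw [← card_eq_one, card_sdiff_of_subset hSP]
    omega
  have hkP : (k, y) ∈ P := (mem_sdiff.1 (hk ▸ mem_singleton_self _)).1
  have hkS : (k, y) ∉ S := (mem_sdiff.1 (hk ▸ mem_singleton_self _)).2
  have hmemS : ∀ c z, (c, z) ∈ P → (c, z) ≠ (k, y) → (c, z) ∈ S := by
    intro c z hc hne
    by_contra h
    exact hne (mem_singleton.1 (hk ▸ mem_sdiff.2 ⟨hc, h⟩))
  have hblocked : ∀ c z, (c, z) ∈ S → ¬ Free P 0 z := fun c z hc =>
    (mem_blockedEnds.1 (hSimg ▸ mem_image_of_mem Prod.snd hc)).2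
  have huniq : ∀ c c' z, z ≠ y → (c, z) ∈ P → (c', z) ∈ P → c = c' := by
    intro c c' z hz hc hc'
    exact congrArg Prod.fst (hSinj (hmemS c z hc (by simp [hz])) (hmemS c' z hc' (by simp [hz])) rfl)
  by_cases hy : Free P 0 y
  · obtain ⟨z, hz1, hzp, hzb, hzf⟩ := hmin _ hkP
    rcases lt_trichotomy z y with hzy | rfl | hzy
    · exact hzb (hzf.mono fun c d _ hd hm => mem_erase.2 ⟨by simp; omega, hm⟩)
    · exact hzb hy
    · exact hzb (Free.of_erase_of_free hP' hkP hy huniq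
        (fun c z hz hc => hblocked c z (hmemS c z hc (by simp [hz]))) hzy hzf)
  · have hblocked' : ∀ c z, (c, z) ∈ P → ¬ Free P 0 z := by
      intro c z hc
      by_cases he : (c, z) = (k, y)
      · rw [(Prod.mk.inj he).2]
        exact hy
      · exact hblocked c z (hmemS c z hc he)
    have hky := hP k y hkP
    obtain ⟨⟨k', y'⟩, hk'S, rfl⟩ := mem_image.1
      (hSimg.symm ▸ mem_blockedEnds.2 ⟨⟨by omega, hky.2⟩, hy⟩ : y ∈ S.image Prod.snd)
    simp only at *
    have hk'P := hSP hk'S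
    have hky' := hP k' y' hk'P
    have hkk' : k ≠ k' := by
      rintro rfl
      exact hkS hk'S
    have hcovy : (y' - 1, y' + 1) ∈ P := by
      refine hcov y' (by omega) hky.2 (Or.inl ?_)
      exact one_lt_card.2 ⟨(k, y'), by simp [hkP], (k', y'), by simp [hk'P], by simp [hkk']⟩
    have hy2 : (y' - 2, y') ∈ P := by
      by_contra hm
      refine hblocked' _ _ hcovy ((Free.iff_of_unique (j := y' - 1) (by omega) (by omega) hcovy
        fun c hc => huniq _ _ _ (by omega) hc hcovy).2
          ⟨y' - 2, y', by omega, by omega, by omega, by omega, .tri (w := y' - 1) ?_ ?_ hm⟩)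
      · convert Free.side (P := P) (y' - 2)
        omega
      · convert Free.side (P := P) (y' - 1)
        omega
    obtain ⟨i, hi, hiy⟩ : ∃ i, (i, y') ∈ P ∧ i + 3 ≤ y' := by
      by_cases h : k + 3 ≤ y'
      · exact ⟨k, hkP, h⟩
      · exact ⟨k', hk'P, by omega⟩
    have hcovy2 : (y' - 2 - 1, y' - 2 + 1) ∈ P := by
      refine hcov (y' - 2) (by omega) (by omega) ?_
      by_cases hf : Free P 0 (y' - 2)
      · exact Or.inr ⟨hf, card_pos.2 ⟨(y' - 2, y'), by simp [hy2]⟩⟩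
      · obtain ⟨c, -, hc, hcm⟩ := Free.exists_mem_of_not hf (by omega)
        refine Or.inl (one_lt_card.2 ⟨(y' - 2, y'), by simp [hy2], (c, y' - 2), by simp [hcm], ?_⟩)
        simp
        omega
    rw [show y' - 2 - 1 = y' - 3 by omega, show y' - 2 + 1 = y' - 1 by omega] at hcovy2
    obtain ⟨z, -, -, hzb, hzf⟩ := hmin _ hi
    exact hzb (Free.of_erase_of_two hi hiy huniq hblocked' hcovy hcovy2 hzf)

/-- Outside the degenerate case `p = 1`, a vertex of large total degree is covered. -/
theorem mem_of_two_le_deg {r : ℕ} (hp : 2 ≤ p)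
    (hr : 1 ≤ r) (hcard : #(freeEnds P p) * r + #P ≤ p + r)
    (hno : ∀ w, 1 ≤ w → w ≤ p → (w - 1, w + 1) ∉ P → Free P 0 w → pairDeg P w + r ≠ 2)
    (hno' : ∀ w, 1 ≤ w → w ≤ p → (w - 1, w + 1) ∉ P → ¬ Free P 0 w → pairDeg P w ≠ 2)
    (hw1 : 1 ≤ w) (hwp : w ≤ p)
    (hdeg : 2 ≤ pairDeg P w ∨ (Free P 0 w ∧ 2 ≤ pairDeg P w + r)) : (w - 1, w + 1) ∈ P := by
  by_contra hm
  have hsum := card_freeEnds_add_card_blockedEnds (P := P) (p := p)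
  have hle := pairDeg_add_card_erase_le (p := p) hw1 hm
  have hl1 : 1 ≤ #(freeEnds P p) := card_pos.2 ⟨1, one_mem_freeEnds (by omega)⟩
  by_cases hf : Free P 0 w
  · have := hno w hw1 hwp hm hf
    rw [erase_eq_of_notMem (by simp [mem_blockedEnds, hf])] at hle
    have hl : 2 ≤ #(freeEnds P p) := by
      by_cases hw : w = 1
      · subst hw
        refine one_lt_card.2 ⟨1, one_mem_freeEnds (by omega), 2, ?_, by omega⟩
        exact mem_freeEnds.2 ⟨⟨by omega, hp⟩, .tri (.side 0) (.side 1) hm⟩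
      · exact one_lt_card.2 ⟨1, one_mem_freeEnds (by omega), w,
          mem_freeEnds.2 ⟨⟨hw1, hwp⟩, hf⟩, fun h => hw h.symm⟩
    have : pairDeg P w + r ≤ 2 := by nlinarith
    omega
  · have := hno' w hw1 hwp hm hf
    rw [card_erase_of_mem (mem_blockedEnds.2 ⟨⟨hw1, hwp⟩, hf⟩)] at hle
    have : #(freeEnds P p) + r ≤ #(freeEnds P p) * r + 1 := by nlinarith
    have : pairDeg P w ≤ 2 := by omega
    have := hdeg.resolve_right fun h => hf h.1
    omega

/-- The two sides of a pendant edge in a saturated blocker of size one above the minimum cannot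
both be free of uncovered vertices of degree two. -/
theorem two_sided_contradiction
    (hP : ∀ a b, (a, b) ∈ P → a + 2 ≤ b ∧ b ≤ p) (hQ : ∀ a b, (a, b) ∈ Q → a + 2 ≤ b ∧ b ≤ q)
    (hp : 1 ≤ p) (hq : 1 ≤ q)
    (hminP : ∀ e ∈ P, ∃ z, 1 ≤ z ∧ z ≤ p ∧ ¬ Free P 0 z ∧ Free (P.erase e) 0 z)
    (hminQ : ∀ e ∈ Q, ∃ z, 1 ≤ z ∧ z ≤ q ∧ ¬ Free Q 0 z ∧ Free (Q.erase e) 0 z)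
    (hcard : #(freeEnds P p) * #(freeEnds Q q) + #P + #Q = p + q)
    (hnoP : 2 ≤ p → ∀ w, 1 ≤ w → w ≤ p → (w - 1, w + 1) ∉ P →
      (Free P 0 w → pairDeg P w + #(freeEnds Q q) ≠ 2) ∧ (¬ Free P 0 w → pairDeg P w ≠ 2))
    (hnoQ : 2 ≤ q → ∀ w, 1 ≤ w → w ≤ q → (w - 1, w + 1) ∉ Q →
      (Free Q 0 w → pairDeg Q w + #(freeEnds P p) ≠ 2) ∧ (¬ Free Q 0 w → pairDeg Q w ≠ 2)) :
    False := by
  have hsumP := card_freeEnds_add_card_blockedEnds (P := P) (p := p)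
  have hsumQ := card_freeEnds_add_card_blockedEnds (P := Q) (p := q)
  have hleP := card_blockedEnds_le (P := P) (p := p)
  have hleQ := card_blockedEnds_le (P := Q) (p := q)
  have hl : 1 ≤ #(freeEnds P p) := card_pos.2 ⟨1, one_mem_freeEnds hp⟩
  have hr : 1 ≤ #(freeEnds Q q) := card_pos.2 ⟨1, one_mem_freeEnds hq⟩
  have hcovP : 2 ≤ p → ∀ w, 1 ≤ w → w ≤ p →
      2 ≤ pairDeg P w ∨ (Free P 0 w ∧ 2 ≤ pairDeg P w + #(freeEnds Q q)) → (w - 1, w + 1) ∈ P :=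
    fun h2 w h h' hd => mem_of_two_le_deg h2 hr (by omega)
      (fun w h h' hm => (hnoP h2 w h h' hm).1) (fun w h h' hm => (hnoP h2 w h h' hm).2) h h' hd
  have hcovQ : 2 ≤ q → ∀ w, 1 ≤ w → w ≤ q →
      2 ≤ pairDeg Q w ∨ (Free Q 0 w ∧ 2 ≤ pairDeg Q w + #(freeEnds P p)) → (w - 1, w + 1) ∈ Q :=
    fun h2 w h h' hd => mem_of_two_le_deg h2 hl (by rw [mul_comm]; omega)
      (fun w h h' hm => (hnoQ h2 w h h' hm).1) (fun w h h' hm => (hnoQ h2 w h h' hm).2) h h' hd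
  have two_le : ∀ {P : Finset (ℕ × ℕ)} {p w : ℕ}, (∀ a b, (a, b) ∈ P → a + 2 ≤ b ∧ b ≤ p) →
      1 ≤ pairDeg P w → 2 ≤ p := by
    intro P p w hP h
    obtain ⟨⟨a, b⟩, he⟩ := card_pos.1 h
    have := hP a b (mem_filter.1 he).1
    omega
  have hneP : #P ≠ #(blockedEnds P p) + 1 := card_ne_succ hP hminP fun w h h' hd =>
    hcovP (two_le (w := w) hP (by omega)) w h h' (hd.imp_right fun hd => ⟨hd.1, by omega⟩)
  have hneQ : #Q ≠ #(blockedEnds Q q) + 1 := card_ne_succ hQ hminQ fun w h h' hd =>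
    hcovQ (two_le (w := w) hQ (by omega)) w h h' (hd.imp_right fun hd => ⟨hd.1, by omega⟩)
  have hmul : #(freeEnds P p) + #(freeEnds Q q) ≤ #(freeEnds P p) * #(freeEnds Q q) + 1 := by
    nlinarith
  have hPeq : #P = #(blockedEnds P p) := by omega
  have hQeq : #Q = #(blockedEnds Q q) := by omega
  have hlr : #(freeEnds P p) * #(freeEnds Q q) = #(freeEnds P p) + #(freeEnds Q q) := by omega
  have hl2 : 1 < #(freeEnds P p) := by
    by_contra h
    rw [show #(freeEnds P p) = 1 by omega] at hlr
    omega
  have hr2 : 2 ≤ #(freeEnds Q q) := by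
    by_contra h
    rw [show #(freeEnds Q q) = 1 by omega] at hlr
    omega
  obtain ⟨y, hy, hy1⟩ := exists_mem_ne hl2 1
  obtain ⟨⟨h1, hyp⟩, hf⟩ := mem_freeEnds.1 hy
  exact notMem_of_card_eq hPeq (by omega) hf
    (hcovP (by omega) y h1 hyp (Or.inr ⟨hf, by omega⟩))

namespace Free

variable {W : Finset (ℕ × ℕ)} {X a b y : ℕ}

theorem shift_iff (h : ∀ a b, X + b ≤ y → ((a, b) ∈ P ↔ (X + a, X + b) ∈ W)) (hb : X + b ≤ y) :
    Free P a b ↔ Free W (X + a) (X + b) := by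
  constructor
  · intro hf
    induction hf with
    | side a => exact side (X + a)
    | tri h₁ h₂ hm ih₁ ih₂ =>
      have := h₂.lt
      exact tri (ih₁ (by omega)) (ih₂ hb) fun hm' => hm ((h _ _ hb).2 hm')
  · suffices ∀ c d, Free W c d → X ≤ c → d ≤ y → Free P (c - X) (d - X) by
      intro hf
      simpa using this _ _ hf (by omega) hb
    intro c d hf
    induction hf with
    | side a =>
      intro hX _
      rw [show a + 1 - X = a - X + 1 by omega]
      exact side _
    | tri h₁ h₂ hm ih₁ ih₂ =>
      intro hX hy
      have := h₁.lt
      have := h₂.lt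
      refine tri (ih₁ hX (by omega)) (ih₂ (by omega) hy) fun hm' => hm ?_
      have := (h _ _ (by omega)).1 hm'
      rwa [Nat.add_sub_cancel' hX, Nat.add_sub_cancel' (by omega)] at this

theorem reflect_iff (h : ∀ a b, a < b → b ≤ X → ((a, b) ∈ P ↔ (X - b, X - a) ∈ W))
    (hab : a < b) (hb : b ≤ X) : Free P a b ↔ Free W (X - b) (X - a) := by
  constructor
  · intro hf
    clear hab
    induction hf with
    | side a =>
      rw [show X - a = X - (a + 1) + 1 by omega]
      exact side _
    | tri h₁ h₂ hm ih₁ ih₂ =>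
      have := h₁.lt
      have := h₂.lt
      exact tri (ih₂ hb) (ih₁ (by omega)) fun hm' => hm ((h _ _ (by omega) hb).2 hm')
  · suffices ∀ c d, Free W c d → d ≤ X → Free P (X - d) (X - c) by
      intro hf
      have := this _ _ hf (by omega)
      rwa [Nat.sub_sub_self hb, Nat.sub_sub_self (by omega)] at this
    intro c d hf
    induction hf with
    | side a =>
      intro hX
      rw [show X - a = X - (a + 1) + 1 by omega]
      exact side _
    | tri h₁ h₂ hm ih₁ ih₂ =>
      intro hX
      have := h₁.lt
      have := h₂.lt
      refine tri (ih₂ hX) (ih₁ (by omega)) fun hm' => hm ?_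
      have := (h _ _ (by omega) (by omega)).1 hm'
      rwa [Nat.sub_sub_self hX, Nat.sub_sub_self (by omega)] at this

end Free

theorem pairDeg_union {w : ℕ} (h : Disjoint P Q) :
    pairDeg (P ∪ Q) w = pairDeg P w + pairDeg Q w := by
  rw [pairDeg, filter_union, card_union_of_disjoint (disjoint_filter_filter h)]
  rfl

theorem pairDeg_eq_zero {w : ℕ} (h : ∀ a b, (a, b) ∈ P → a ≠ w ∧ b ≠ w) : pairDeg P w = 0 := by
  rw [pairDeg, card_eq_zero, filter_eq_empty_iff]
  rintro ⟨a, b⟩ hm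
  simpa using h a b hm

/-- `Free` version of the main result: the vertex `N` carries a single edge, to `X`. -/
theorem pendant_contradiction {W : Finset (ℕ × ℕ)} {N X : ℕ}
    (hW : ∀ a b, (a, b) ∈ W → a + 2 ≤ b ∧ b ≤ N) (hX1 : 1 ≤ X) (hXN : X + 2 ≤ N)
    (hXmem : (X, N) ∈ W) (hXu : ∀ c, (c, N) ∈ W → c = X)
    (hblk : ¬ Free W 0 N) (hsat : ∀ e ∈ W, Free (W.erase e) 0 N) (hcard : #W = N)
    (hno : ∀ w, 1 ≤ w → w < N → (w - 1, w + 1) ∉ W → pairDeg W w ≠ 2)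
    (hno0 : X ≠ 1 → pairDeg W 0 ≠ 2) : False := by
  classical
  have hblk' : ∀ c d, c < X → X < d → d < N → Free W c X → Free W X d → (c, d) ∈ W := by
    rw [← Free.forall_not_iff]
    intro c d hc hd hdN hf
    exact hblk ((Free.iff_of_unique (by omega) hXN hXmem hXu).2
      ⟨c, d, by omega, hc, hd, hdN, hf⟩)
  have hsat' : ∀ e ∈ W, e ≠ (X, N) → ∃ c d, c < X ∧ X < d ∧ d < N ∧
      Free (W.erase e) c X ∧ Free (W.erase e) X d ∧ (c, d) ∉ W.erase e := by
    intro e he hne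
    obtain ⟨c, d, -, hc, hd, hdN, hf⟩ := (Free.iff_of_unique (by omega) hXN
      (mem_erase.2 ⟨hne.symm, hXmem⟩) fun c hc => hXu c (mem_of_mem_erase hc)).1 (hsat e he)
    by_contra! hcon
    exact Free.forall_not_iff.2 hcon c d hc hd hdN hf
  set FL : Finset (ℕ × ℕ) := {e ∈ W | e.2 ≤ X} with hFL
  set FR : Finset (ℕ × ℕ) := {e ∈ W | X ≤ e.1 ∧ e.2 < N} with hFR
  set P : Finset (ℕ × ℕ) := FL.image fun e => (X - e.2, X - e.1) with hPdef
  set Q : Finset (ℕ × ℕ) := FR.image fun e => (e.1 - X, e.2 - X) with hQdef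
  have memP : ∀ a b, (a, b) ∈ P ↔ b ≤ X ∧ (X - b, X - a) ∈ W := by
    intro a b
    simp only [hPdef, hFL, mem_image, mem_filter, Prod.mk.injEq, Prod.exists]
    constructor
    · rintro ⟨c, d, ⟨hm, hd⟩, rfl, rfl⟩
      have := hW c d hm
      rw [Nat.sub_sub_self hd, Nat.sub_sub_self (by omega)]
      exact ⟨by omega, hm⟩
    · rintro ⟨hb, hm⟩
      have := hW _ _ hm
      exact ⟨_, _, ⟨hm, by omega⟩, by omega, by omega⟩
  have memQ : ∀ a b, (a, b) ∈ Q ↔ X + b < N ∧ (X + a, X + b) ∈ W := by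
    intro a b
    simp only [hQdef, hFR, mem_image, mem_filter, Prod.mk.injEq, Prod.exists]
    constructor
    · rintro ⟨c, d, ⟨hm, hc, hd⟩, rfl, rfl⟩
      have := hW c d hm
      rw [Nat.add_sub_cancel' hc, Nat.add_sub_cancel' (by omega)]
      exact ⟨hd, hm⟩
    · rintro ⟨hb, hm⟩
      exact ⟨_, _, ⟨hm, by omega, hb⟩, by omega, by omega⟩
  have hP : ∀ a b, (a, b) ∈ P → a + 2 ≤ b ∧ b ≤ X := by
    intro a b hm
    obtain ⟨hb, hm⟩ := (memP a b).1 hm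
    have := hW _ _ hm
    omega
  have hQ : ∀ a b, (a, b) ∈ Q → a + 2 ≤ b ∧ b ≤ N - 1 - X := by
    intro a b hm
    obtain ⟨hb, hm⟩ := (memQ a b).1 hm
    have := hW _ _ hm
    omega
  have freeP : ∀ y, 1 ≤ y → y ≤ X → (Free P 0 y ↔ Free W (X - y) X) := fun y hy hyX =>
    Free.reflect_iff (a := 0) (fun a b _ hb => by simp [memP, hb]) hy hyX
  have freeQ : ∀ z, X + z ≤ N - 1 → (Free Q 0 z ↔ Free W X (X + z)) := fun z hz =>
    Free.shift_iff (a := 0) (y := N - 1)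
      (fun a b hb => by simp [memQ, show X + b < N by omega]) hz
  set C : Finset (ℕ × ℕ) :=
    (freeEnds P X ×ˢ freeEnds Q (N - 1 - X)).image fun e => (X - e.1, X + e.2) with hC
  have memC : ∀ a b, (a, b) ∈ C ↔ a < X ∧ X < b ∧ b < N ∧ Free W a X ∧ Free W X b := by
    intro a b
    simp only [hC, mem_image, mem_product, mem_freeEnds, Prod.mk.injEq, Prod.exists]
    constructor
    · rintro ⟨y, z, ⟨⟨⟨hy, hyX⟩, hfy⟩, ⟨hz, hzX⟩, hfz⟩, rfl, rfl⟩
      exact ⟨by omega, by omega, by omega, (freeP y hy hyX).1 hfy, (freeQ z (by omega)).1 hfz⟩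
    · rintro ⟨ha, hb, hbN, hfa, hfb⟩
      refine ⟨X - a, b - X, ⟨⟨⟨by omega, by omega⟩, ?_⟩, ⟨by omega, by omega⟩, ?_⟩,
        by omega, by omega⟩
      · rwa [freeP _ (by omega) (by omega), Nat.sub_sub_self ha.le]
      · rwa [freeQ _ (by omega), Nat.add_sub_cancel' hb.le]
  have hCW : ∀ a b, a < X → X < b → b < N → (a, b) ∈ W → (a, b) ∈ C := by
    intro a b ha hb hbN hm
    obtain ⟨c, d, hc, hd, hdN, hfc, hfd, hcd⟩ := hsat' _ hm (by simp; omega)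
    have hfc' : Free W c X := hfc.mono fun c' d' _ h hm' => mem_erase.2 ⟨by simp; omega, hm'⟩
    have hfd' : Free W X d := hfd.mono fun c' d' h _ hm' => mem_erase.2 ⟨by simp; omega, hm'⟩
    have heq : (c, d) = (a, b) := by
      by_contra hne
      exact hcd (mem_erase.2 ⟨hne, hblk' c d hc hd hdN hfc' hfd'⟩)
    obtain ⟨rfl, rfl⟩ := Prod.mk.inj heq
    exact (memC _ _).2 ⟨ha, hb, hbN, hfc', hfd'⟩
  have hsplit : W = FL ∪ (FR ∪ (C ∪ {(X, N)})) := by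
    ext ⟨a, b⟩
    simp only [mem_union, hFL, hFR, mem_filter, mem_singleton, Prod.mk.injEq]
    constructor
    · intro hm
      have := hW a b hm
      have := hXu a
      have := hCW a b
      grind
    · rintro (h | h | h | ⟨rfl, rfl⟩)
      · exact h.1
      · exact h.1
      · obtain ⟨ha, hb, hbN, hfa, hfb⟩ := (memC a b).1 h
        exact hblk' a b ha hb hbN hfa hfb
      · exact hXmem
  have hd₃ : Disjoint C {(X, N)} := by
    rw [disjoint_singleton_right, memC]
    omega
  have hd₂ : Disjoint FR (C ∪ {(X, N)}) := by
    rw [disjoint_left]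
    rintro ⟨a, b⟩ h h'
    simp only [hFR, mem_filter, mem_union, memC, mem_singleton, Prod.mk.injEq] at h h'
    omega
  have hd₁ : Disjoint FL (FR ∪ (C ∪ {(X, N)})) := by
    rw [disjoint_left]
    rintro ⟨a, b⟩ h h'
    simp only [hFL, hFR, mem_filter, mem_union, memC, mem_singleton, Prod.mk.injEq] at h h'
    have := hW a b h.1
    omega
  have hinjP : Set.InjOn (fun e : ℕ × ℕ => (X - e.2, X - e.1)) (FL : Set (ℕ × ℕ)) := by
    rintro ⟨a, b⟩ h ⟨a', b'⟩ h' heq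
    simp only [hFL, mem_coe, mem_filter, Prod.mk.injEq] at h h' heq ⊢
    have := hW a b h.1
    have := hW a' b' h'.1
    omega
  have hinjQ : Set.InjOn (fun e : ℕ × ℕ => (e.1 - X, e.2 - X)) (FR : Set (ℕ × ℕ)) := by
    rintro ⟨a, b⟩ h ⟨a', b'⟩ h' heq
    simp only [hFR, mem_coe, mem_filter, Prod.mk.injEq] at h h' heq ⊢
    have := hW a b h.1
    have := hW a' b' h'.1
    omega
  have hinjC : Set.InjOn (fun e : ℕ × ℕ => (X - e.1, X + e.2))
      (freeEnds P X ×ˢ freeEnds Q (N - 1 - X) : Finset (ℕ × ℕ)) := by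
    rintro ⟨a, b⟩ h ⟨a', b'⟩ h' heq
    simp only [coe_product, Set.mem_prod, mem_coe, mem_freeEnds, Prod.mk.injEq] at h h' heq ⊢
    omega
  have hcardP : #P = #FL := card_image_of_injOn hinjP
  have hcardQ : #Q = #FR := card_image_of_injOn hinjQ
  have hcardC : #C = #(freeEnds P X) * #(freeEnds Q (N - 1 - X)) := by
    rw [hC, card_image_of_injOn hinjC, card_product]
  have htotal : #(freeEnds P X) * #(freeEnds Q (N - 1 - X)) + #P + #Q = X + (N - 1 - X) := by
    have := congrArg card hsplit
    rw [card_union_of_disjoint hd₁, card_union_of_disjoint hd₂, card_union_of_disjoint hd₃,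
      card_singleton, hcard, ← hcardP, ← hcardQ, hcardC] at this
    omega
  have hdeg : ∀ u, pairDeg W u = pairDeg FL u + pairDeg FR u + pairDeg C u + pairDeg {(X, N)} u := by
    intro u
    conv_lhs => rw [hsplit]
    rw [pairDeg_union hd₁, pairDeg_union hd₂, pairDeg_union hd₃]
    omega
  have hdegL : ∀ w, 1 ≤ w → w ≤ X → pairDeg W (X - w) =
      pairDeg P w + if Free P 0 w then #(freeEnds Q (N - 1 - X)) else 0 := by
    intro w hw hwX
    have h₁ : pairDeg FL (X - w) = pairDeg P w := by
      rw [pairDeg, pairDeg, hPdef, filter_image, card_image_of_injOn (hinjP.mono (coe_subset.2 (filter_subset _ _)))]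
      congr 1
      ext ⟨a, b⟩
      simp only [hFL, mem_filter]
      refine and_congr_right fun h => ?_
      have := hW a b h.1
      omega
    have h₂ : pairDeg FR (X - w) = 0 := pairDeg_eq_zero fun a b h => by
      simp only [hFR, mem_filter] at h
      have := hW a b h.1
      omega
    have h₃ : pairDeg {(X, N)} (X - w) = 0 := pairDeg_eq_zero fun a b h => by
      simp only [mem_singleton, Prod.mk.injEq] at h
      omega
    have h₄ : pairDeg C (X - w) = if Free P 0 w then #(freeEnds Q (N - 1 - X)) else 0 := by
      split_ifs with hf
      · rw [pairDeg, ← card_image_of_injective (f := fun z => (X - w, X + z)) (freeEnds Q _)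
          fun z z' h => by simpa using h]
        congr 1
        ext ⟨a, b⟩
        simp only [mem_filter, memC, mem_image, mem_freeEnds, Prod.mk.injEq]
        constructor
        · rintro ⟨⟨ha, hb, hbN, hfa, hfb⟩, h⟩
          refine ⟨b - X, ⟨⟨by omega, by omega⟩, ?_⟩, by omega, by omega⟩
          rwa [freeQ _ (by omega), Nat.add_sub_cancel' hb.le]
        · rintro ⟨z, ⟨⟨hz, hzN⟩, hfz⟩, rfl, rfl⟩
          exact ⟨⟨by omega, by omega, by omega, (freeP w hw hwX).1 hf,
            (freeQ z (by omega)).1 hfz⟩, Or.inl rfl⟩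
      · refine pairDeg_eq_zero fun a b h => ?_
        obtain ⟨ha, hb, hbN, hfa, hfb⟩ := (memC a b).1 h
        refine ⟨?_, by omega⟩
        rintro rfl
        exact hf ((freeP w hw hwX).2 hfa)
    rw [hdeg, h₁, h₂, h₃, h₄]
    omega
  have hdegR : ∀ w, 1 ≤ w → w ≤ N - 1 - X → pairDeg W (X + w) =
      pairDeg Q w + if Free Q 0 w then #(freeEnds P X) else 0 := by
    intro w hw hwX
    have h₁ : pairDeg FR (X + w) = pairDeg Q w := by
      rw [pairDeg, pairDeg, hQdef, filter_image, card_image_of_injOn (hinjQ.mono (coe_subset.2 (filter_subset _ _)))]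
      congr 1
      ext ⟨a, b⟩
      simp only [hFR, mem_filter]
      refine and_congr_right fun h => ?_
      have := hW a b h.1
      omega
    have h₂ : pairDeg FL (X + w) = 0 := pairDeg_eq_zero fun a b h => by
      simp only [hFL, mem_filter] at h
      have := hW a b h.1
      omega
    have h₃ : pairDeg {(X, N)} (X + w) = 0 := pairDeg_eq_zero fun a b h => by
      simp only [mem_singleton, Prod.mk.injEq] at h
      omega
    have h₄ : pairDeg C (X + w) = if Free Q 0 w then #(freeEnds P X) else 0 := by
      split_ifs with hf
      · rw [pairDeg, ← card_image_of_injOn (f := fun y => (X - y, X + w)) (s := freeEnds P X)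
          fun y hy y' hy' h => by
            simp only [mem_coe, mem_freeEnds, Prod.mk.injEq] at hy hy' h
            omega]
        congr 1
        ext ⟨a, b⟩
        simp only [mem_filter, memC, mem_image, mem_freeEnds, Prod.mk.injEq]
        constructor
        · rintro ⟨⟨ha, hb, hbN, hfa, hfb⟩, h⟩
          refine ⟨X - a, ⟨⟨by omega, by omega⟩, ?_⟩, by omega, by omega⟩
          rwa [freeP _ (by omega) (by omega), Nat.sub_sub_self ha.le]
        · rintro ⟨y, ⟨⟨hy, hyN⟩, hfy⟩, rfl, rfl⟩
          exact ⟨⟨by omega, by omega, by omega, (freeP y hy hyN).1 hfy,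
            (freeQ w (by omega)).1 hf⟩, Or.inr rfl⟩
      · refine pairDeg_eq_zero fun a b h => ?_
        obtain ⟨ha, hb, hbN, hfa, hfb⟩ := (memC a b).1 h
        refine ⟨by omega, ?_⟩
        rintro rfl
        exact hf ((freeQ w (by omega)).2 hfb)
    rw [hdeg, h₁, h₂, h₃, h₄]
    omega
  refine two_sided_contradiction hP hQ hX1 (by omega) ?_ ?_ htotal ?_ ?_
  · rintro ⟨a, b⟩ he
    have hab := hP a b he
    have heW := ((memP a b).1 he).2
    obtain ⟨c, d, hc, hd, hdN, hfc, hfd, hcd⟩ := hsat' _ heW (by simp; omega)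
    have hfd' : Free W X d := hfd.mono fun c' d' h _ hm' => mem_erase.2 ⟨by simp; omega, hm'⟩
    refine ⟨X - c, by omega, by omega, ?_, ?_⟩
    · rw [freeP _ (by omega) (by omega), Nat.sub_sub_self hc.le]
      intro hfc'
      exact hcd (mem_erase.2 ⟨by simp; omega, hblk' c d hc hd hdN hfc' hfd'⟩)
    · rw [Free.reflect_iff (X := X) (W := W.erase (X - b, X - a)) _ (by omega) (by omega),
        Nat.sub_sub_self hc.le]
      · exact hfc
      · intro a' b' hab' hb'
        simp only [mem_erase, memP, hb', true_and, ne_eq, Prod.mk.injEq]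
        refine and_congr_left fun _ => not_congr ?_
        omega
  · rintro ⟨a, b⟩ he
    have hab := hQ a b he
    have heW := ((memQ a b).1 he).2
    obtain ⟨c, d, hc, hd, hdN, hfc, hfd, hcd⟩ := hsat' _ heW (by simp; omega)
    have hfc' : Free W c X := hfc.mono fun c' d' _ h hm' => mem_erase.2 ⟨by simp; omega, hm'⟩
    refine ⟨d - X, by omega, by omega, ?_, ?_⟩
    · rw [freeQ _ (by omega), Nat.add_sub_cancel' hd.le]
      intro hfd'
      exact hcd (mem_erase.2 ⟨by simp; omega, hblk' c d hc hd hdN hfc' hfd'⟩)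
    · rw [Free.shift_iff (X := X) (y := N - 1) (W := W.erase (X + a, X + b)) _ (by omega),
        Nat.add_sub_cancel' hd.le]
      · exact hfd
      · intro a' b' hb'
        simp [mem_erase, memQ, show X + b' < N by omega]
  · intro h2 w hw hwX hcov
    have hne : pairDeg W (X - w) ≠ 2 := by
      rcases hwX.eq_or_lt with rfl | hlt
      · simpa using hno0 (by omega)
      · refine hno _ (by omega) (by omega) fun hm => hcov ((memP _ _).2 ⟨by omega, ?_⟩)
        convert hm using 2 <;> omega
    rw [hdegL w hw hwX] at hne
    constructor <;> intro hf <;> simpa [hf] using hne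
  · intro h2 w hw hwX hcov
    have hne : pairDeg W (X + w) ≠ 2 := by
      refine hno _ (by omega) (by omega) fun hm => ?_
      rcases hwX.eq_or_lt with rfl | hlt
      · have := hXu (X + (N - 1 - X) - 1) (by convert hm using 2; omega)
        omega
      · refine hcov ((memQ _ _).2 ⟨by omega, ?_⟩)
        convert hm using 2 <;> omega
    rw [hdegR w hw hwX] at hne
    constructor <;> intro hf <;> simpa [hf] using hne

/-- The vertex `o + k` of the `n`-gon. -/
abbrev vert (n : ℕ) (o : ZMod n) (k : ℕ) : ZMod n := o + (k : ZMod n)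

section Vert

variable {n : ℕ} {o : ZMod n} {a b c d : ℕ}

theorem val_vert_sub_vert (ha : a < n) (hb : b < n) :
    (vert n o b - vert n o a).val = if a ≤ b then b - a else n + b - a := by
  have h : vert n o b - vert n o a = ((b + (n - a) : ℕ) : ZMod n) := by
    push_cast [Nat.cast_sub ha.le]
    simp only [vert, CharP.cast_eq_zero]
    ring
  rw [h, ZMod.val_natCast]
  split_ifs with hab
  · rw [show b + (n - a) = b - a + n by omega, Nat.add_mod_right, Nat.mod_eq_of_lt (by omega)]
  · rw [Nat.mod_eq_of_lt (by omega)]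
    omega

theorem vert_inj (ha : a < n) (hb : b < n) : vert n o a = vert n o b ↔ a = b := by
  refine ⟨fun h => ?_, fun h => by rw [h]⟩
  have h₁ := val_vert_sub_vert (o := o) ha hb
  have h₂ := val_vert_sub_vert (o := o) hb ha
  rw [h, sub_self, ZMod.val_zero] at h₁ h₂
  split_ifs at h₁ h₂ <;> omega

theorem exists_vert_eq [NeZero n] (o u : ZMod n) : ∃ k < n, vert n o k = u :=
  ⟨(u - o).val, ZMod.val_lt _, by simp [vert]⟩

theorem exists_vert_pair_eq [NeZero n] (o : ZMod n) {u u' : ZMod n} (h : u ≠ u') :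
    ∃ a b, a < b ∧ b < n ∧ s(u, u') = s(vert n o a, vert n o b) := by
  obtain ⟨a, ha, rfl⟩ := exists_vert_eq o u
  obtain ⟨b, hb, rfl⟩ := exists_vert_eq o u'
  rcases lt_trichotomy a b with hab | rfl | hab
  · exact ⟨a, b, hab, hb, rfl⟩
  · exact absurd rfl h
  · exact ⟨b, a, hab, ha, Sym2.eq_swap⟩

theorem vert_pair_inj (hab : a < b) (hb : b < n) (hcd : c < d) (hd : d < n) :
    s(vert n o a, vert n o b) = s(vert n o c, vert n o d) ↔ a = c ∧ b = d := by
  rw [Sym2.eq_iff, vert_inj (by omega) (by omega), vert_inj (by omega) (by omega),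
    vert_inj (by omega) (by omega), vert_inj (by omega) (by omega)]
  omega

theorem cross_vert_iff (hab : a < b) (hb : b < n) (hcd : c < d) (hd : d < n) :
    Cross n s(vert n o a, vert n o b) s(vert n o c, vert n o d) ↔
      (a < c ∧ c < b ∧ b < d) ∨ (c < a ∧ a < d ∧ d < b) := by
  have ha : a < n := hab.trans hb
  have hc : c < n := hcd.trans hd
  constructor
  · rintro ⟨a', b', c', d', he, hf, h⟩
    rcases Sym2.eq_iff.1 he with ⟨rfl, rfl⟩ | ⟨rfl, rfl⟩ <;>
    rcases Sym2.eq_iff.1 hf with ⟨rfl, rfl⟩ | ⟨rfl, rfl⟩ <;>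
    simp only [val_vert_sub_vert, ha, hb, hc, hd] at h <;>
    split_ifs at h <;> omega
  · rintro (h | h)
    · refine ⟨_, _, _, _, rfl, rfl, ?_⟩
      simp only [val_vert_sub_vert, ha, hb, hc, hd]
      split_ifs <;> omega
    · refine ⟨_, _, _, _, rfl, Sym2.eq_swap, ?_⟩
      simp only [val_vert_sub_vert, ha, hb, hc, hd]
      split_ifs <;> omega

theorem btw_vert_iff (ha : a < n) (hb : b < n) (hc : c < n) :
    Btw n (vert n o a) (vert n o c) (vert n o b) ↔
      (a < c ∧ c < b) ∨ (b < a ∧ a < c) ∨ (c < b ∧ b < a) := by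
  simp only [Btw, val_vert_sub_vert, ha, hb, hc]
  split_ifs <;> omega

theorem isDiagonal_vert_iff [NeZero n] (hab : a < b) (hb : b < n) :
    IsDiagonal n s(vert n o a, vert n o b) ↔ a + 2 ≤ b ∧ ¬ (a = 0 ∧ b + 1 = n) := by
  have ha : a < n := hab.trans hb
  constructor
  · rintro ⟨a', b', he, -, ⟨c, hc⟩, d, hd⟩
    obtain ⟨c, hcn, rfl⟩ := exists_vert_eq o c
    obtain ⟨d, hdn, rfl⟩ := exists_vert_eq o d
    rcases Sym2.eq_iff.1 he with ⟨rfl, rfl⟩ | ⟨rfl, rfl⟩ <;>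
    rw [btw_vert_iff (by omega) (by omega) (by omega)] at hc hd <;> omega
  · rintro ⟨h₁, h₂⟩
    refine ⟨_, _, rfl, by rw [Ne, vert_inj ha hb]; omega, ⟨vert n o (a + 1), ?_⟩, ?_⟩
    · rw [btw_vert_iff (by omega) (by omega) (by omega)]
      omega
    · by_cases hbn : b + 1 = n
      · refine ⟨vert n o 0, ?_⟩
        rw [btw_vert_iff (by omega) (by omega) (by omega)]
        omega
      · refine ⟨vert n o (b + 1), ?_⟩
        rw [btw_vert_iff (by omega) (by omega) (by omega)]
        omega

/-- The edges of `B`, written as increasing pairs of positions counted from `o`. -/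
def edgePairs (n : ℕ) (o : ZMod n) (B : Finset (Sym2 (ZMod n))) : Finset (ℕ × ℕ) :=
  {e ∈ range n ×ˢ range n | e.1 < e.2 ∧ s(vert n o e.1, vert n o e.2) ∈ B}

theorem mem_edgePairs {B : Finset (Sym2 (ZMod n))} :
    (a, b) ∈ edgePairs n o B ↔ a < b ∧ b < n ∧ s(vert n o a, vert n o b) ∈ B := by
  simp only [edgePairs, mem_filter, mem_product, mem_range]
  constructor
  · rintro ⟨h, h'⟩
    exact ⟨h'.1, h.2, h'.2⟩
  · rintro ⟨h, h', h''⟩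
    exact ⟨⟨by omega, h'⟩, h, h''⟩

theorem injOn_edgePairs {B : Finset (Sym2 (ZMod n))} :
    Set.InjOn (fun e : ℕ × ℕ => s(vert n o e.1, vert n o e.2)) (edgePairs n o B : Set (ℕ × ℕ)) := by
  rintro ⟨a, b⟩ h ⟨c, d⟩ h' heq
  obtain ⟨hab, hb, -⟩ := mem_edgePairs.1 (mem_coe.1 h)
  obtain ⟨hcd, hd, -⟩ := mem_edgePairs.1 (mem_coe.1 h')
  exact Prod.ext_iff.2 ((vert_pair_inj hab hb hcd hd).1 heq)

theorem image_edgePairs [NeZero n] {B : Finset (Sym2 (ZMod n))} (hB : ∀ e ∈ B, IsEdge n e) :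
    (edgePairs n o B).image (fun e => s(vert n o e.1, vert n o e.2)) = B := by
  ext e
  simp only [mem_image, Prod.exists, mem_edgePairs]
  constructor
  · rintro ⟨a, b, ⟨-, -, h⟩, rfl⟩
    exact h
  · intro he
    obtain ⟨u, u', rfl, hne⟩ := hB e he
    obtain ⟨a, b, hab, hb, h⟩ := exists_vert_pair_eq o hne
    exact ⟨a, b, ⟨hab, hb, h ▸ he⟩, h.symm⟩

theorem edgePairs_erase {B : Finset (Sym2 (ZMod n))} (hab : a < b) (hb : b < n) :
    edgePairs n o (B.erase s(vert n o a, vert n o b)) = (edgePairs n o B).erase (a, b) := by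
  ext ⟨c, d⟩
  rw [mem_edgePairs, mem_erase, mem_erase, mem_edgePairs]
  constructor
  · rintro ⟨hcd, hd, hne, hm⟩
    refine ⟨fun h => hne ?_, hcd, hd, hm⟩
    obtain ⟨rfl, rfl⟩ := Prod.mk.inj h
    rfl
  · rintro ⟨hne, hcd, hd, hm⟩
    exact ⟨hcd, hd, fun h => hne (Prod.ext_iff.2 ((vert_pair_inj hcd hd hab hb).1 h)), hm⟩

/-- A triangulation avoiding `B` shows that each of its bases is free. -/
theorem IsTriangulation.free [NeZero n] {B T : Finset (Sym2 (ZMod n))} (hT : IsTriangulation n T)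
    (hTB : ∀ e ∈ T, e ∉ B) (hB : ∀ b, b + 1 = n → s(vert n o 0, vert n o b) ∉ B)
    (hab : a < b) (hb : b < n)
    (h : b = a + 1 ∨ (a = 0 ∧ b + 1 = n) ∨ s(vert n o a, vert n o b) ∈ T) :
    Free (edgePairs n o B) a b := by
  induction hm : b - a using Nat.strong_induction_on generalizing a b with
  | _ m ih =>
    subst hm
    by_cases hside : b = a + 1
    · exact hside ▸ .side a
    have hnc : ∀ {a b c d}, a < b → b < n → c < d → d < n → s(vert n o a, vert n o b) ∈ T →
        s(vert n o c, vert n o d) ∈ T → ¬ (a < c ∧ c < b ∧ b < d) := by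
      intro a b c d hab hb hcd hd h h' hc
      exact hT.2.1 _ h _ h' ((cross_vert_iff hab hb hcd hd).2 (Or.inl hc))
    obtain ⟨w, hw, hmax⟩ := exists_max_image
      {w ∈ Ioo a b | w = a + 1 ∨ s(vert n o a, vert n o w) ∈ T} id
      ⟨a + 1, by simp; omega⟩
    simp only [mem_filter, mem_Ioo, id_eq] at hw hmax
    obtain ⟨⟨haw, hwb⟩, hw⟩ := hw
    have hwbT : b = w + 1 ∨ s(vert n o w, vert n o b) ∈ T := by
      by_contra! hcon
      obtain ⟨g, hg, hcr⟩ := hT.2.2 _ ((isDiagonal_vert_iff hwb hb).2 (by omega)) hcon.2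
      obtain ⟨u, u', rfl, hne, -⟩ := hT.1 g hg
      obtain ⟨c, d, hcd, hd, heq⟩ := exists_vert_pair_eq o hne
      rw [heq] at hg hcr
      rw [cross_vert_iff hwb hb hcd hd] at hcr
      rcases hcr with hcr | hcr
      · rcases h with h | h | h
        · omega
        · omega
        · exact hnc hab hb hcd hd h hg (by omega)
      · rcases lt_trichotomy c a with hca | rfl | hca
        · rcases h with h | h | h
          · omega
          · omega
          · exact hnc hcd hd hab hb hg h (by omega)
        · have := hmax d ⟨⟨by omega, by omega⟩, Or.inr hg⟩
          omega
        · rcases hw with hw | hw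
          · omega
          · exact hnc haw (by omega) hcd hd hw hg (by omega)
    refine .tri (ih (w - a) (by omega) haw (by omega) (by tauto) rfl)
      (ih (b - w) (by omega) hwb hb (by tauto) rfl) fun hm => ?_
    obtain ⟨-, -, hm⟩ := mem_edgePairs.1 hm
    rcases h with h | ⟨rfl, h⟩ | h
    · exact hside h
    · exact hB b h hm
    · exact hTB _ h hm

/-- A free interval has a triangulation avoiding `P`. -/
theorem Free.exists_triangulation {P : Finset (ℕ × ℕ)} (h : Free P a b) :
    ∃ T : Finset (ℕ × ℕ), (∀ c d, (c, d) ∈ T → a ≤ c ∧ c + 2 ≤ d ∧ d ≤ b ∧ (c, d) ∉ P) ∧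
      (∀ c d c' d', (c, d) ∈ T → (c', d') ∈ T → ¬ (c < c' ∧ c' < d ∧ d < d')) ∧
      ∀ c d, a ≤ c → c + 2 ≤ d → d ≤ b → (c, d) ∉ T → ∃ c' d', (c', d') ∈ T ∧
        ((c < c' ∧ c' < d ∧ d < d') ∨ (c' < c ∧ c < d' ∧ d' < d)) := by
  induction h with
  | side a => exact ⟨∅, by simp, by simp, fun c d h₁ h₂ h₃ => by omega⟩
  | @tri a w b h₁ h₂ hm ih₁ ih₂ =>
    have haw := h₁.lt
    have hwb := h₂.lt
    obtain ⟨T₁, hP₁, hN₁, hM₁⟩ := ih₁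
    obtain ⟨T₂, hP₂, hN₂, hM₂⟩ := ih₂
    refine ⟨insert (a, b) (T₁ ∪ T₂), ?_, ?_, ?_⟩
    · intro c d h
      simp only [mem_insert, Prod.mk.injEq, mem_union] at h
      rcases h with ⟨rfl, rfl⟩ | h | h
      · exact ⟨le_rfl, by omega, le_rfl, hm⟩
      · have := hP₁ c d h
        exact ⟨by omega, by omega, by omega, this.2.2.2⟩
      · have := hP₂ c d h
        exact ⟨by omega, by omega, by omega, this.2.2.2⟩
    · intro c d c' d' h h'
      simp only [mem_insert, Prod.mk.injEq, mem_union] at h h'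
      rcases h with h | h | h <;> rcases h' with h' | h' | h'
      · omega
      · have := hP₁ c' d' h'
        omega
      · have := hP₂ c' d' h'
        omega
      · have := hP₁ c d h
        omega
      · exact hN₁ c d c' d' h h'
      · have := hP₁ c d h
        have := hP₂ c' d' h'
        omega
      · have := hP₂ c d h
        omega
      · have := hP₂ c d h
        have := hP₁ c' d' h'
        omega
      · exact hN₂ c d c' d' h h'
    · intro c d hc hcd hd hn
      simp only [mem_insert, Prod.mk.injEq, mem_union, not_or] at hn ⊢
      by_cases hdw : d ≤ w
      · obtain ⟨c', d', hm', h'⟩ := hM₁ c d hc hcd hdw hn.2.1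
        exact ⟨c', d', Or.inr (Or.inl hm'), h'⟩
      by_cases hcw : w ≤ c
      · obtain ⟨c', d', hm', h'⟩ := hM₂ c d hcw hcd hd hn.2.2
        exact ⟨c', d', Or.inr (Or.inr hm'), h'⟩
      by_cases hac : a < c
      · refine ⟨a, w, Or.inr (Or.inl ?_), by omega⟩
        by_contra hc'
        obtain ⟨c', d', hm', h'⟩ := hM₁ a w le_rfl (by omega) le_rfl hc'
        have := hP₁ c' d' hm'
        omega
      · refine ⟨w, b, Or.inr (Or.inr ?_), by omega⟩
        by_contra hc'
        obtain ⟨c', d', hm', h'⟩ := hM₂ w b le_rfl (by omega) le_rfl hc'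
        have := hP₂ c' d' hm'
        omega

/-- Blocking all triangulations of the `n`-gon, in terms of `Free`. -/
theorem forall_triangulation_inter_nonempty_iff [NeZero n] {B : Finset (Sym2 (ZMod n))} {N : ℕ}
    (hn : N + 1 = n) (hN : 1 ≤ N) (hB : s(vert n o 0, vert n o N) ∉ B) :
    (∀ T, IsTriangulation n T → (B ∩ T).Nonempty) ↔ ¬ Free (edgePairs n o B) 0 N := by
  constructor
  · intro hblk hf
    obtain ⟨T, hTP, hTN, hTM⟩ := hf.exists_triangulation
    have hmem : ∀ {e}, e ∈ (T.erase (0, N)).image (fun e => s(vert n o e.1, vert n o e.2)) ↔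
        ∃ a b, (a, b) ∈ T ∧ (a, b) ≠ (0, N) ∧ s(vert n o a, vert n o b) = e := by
      intro e
      simp only [mem_image, mem_erase, Prod.exists]
      exact exists₂_congr fun a b => by tauto
    obtain ⟨e, he⟩ := hblk ((T.erase (0, N)).image fun e => s(vert n o e.1, vert n o e.2)) (by
      refine ⟨?_, ?_, ?_⟩
      · intro e he
        obtain ⟨a, b, hab, hne, rfl⟩ := hmem.1 he
        have := hTP a b hab
        rw [isDiagonal_vert_iff (by omega) (by omega)]
        simp only [ne_eq, Prod.mk.injEq] at hne
        omega
      · intro e he e' he'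
        obtain ⟨a, b, hab, -, rfl⟩ := hmem.1 he
        obtain ⟨c, d, hcd, -, rfl⟩ := hmem.1 he'
        have := hTP a b hab
        have := hTP c d hcd
        rw [cross_vert_iff (by omega) (by omega) (by omega) (by omega)]
        exact not_or.2 ⟨hTN a b c d hab hcd, hTN c d a b hcd hab⟩
      · intro e he hne
        have hdiag := he
        obtain ⟨u, u', rfl, huu, -⟩ := he
        obtain ⟨a, b, hab, hb, heq⟩ := exists_vert_pair_eq o huu
        rw [heq] at hne hdiag ⊢
        rw [isDiagonal_vert_iff hab hb] at hdiag
        have hn' : (a, b) ∉ T := fun h => hne (hmem.2 ⟨a, b, h, by simp; omega, rfl⟩)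
        obtain ⟨c, d, hcd, hcr⟩ := hTM a b (by omega) hdiag.1 (by omega) hn'
        have := hTP c d hcd
        refine ⟨_, hmem.2 ⟨c, d, hcd, by simp; omega, rfl⟩, ?_⟩
        rwa [cross_vert_iff hab hb (by omega) (by omega)])
    obtain ⟨heB, heT⟩ := mem_inter.1 he
    obtain ⟨a, b, hab, -, rfl⟩ := hmem.1 heT
    have := hTP a b hab
    exact this.2.2.2 (mem_edgePairs.2 ⟨by omega, by omega, heB⟩)
  · intro hf T hT
    by_contra hne
    rw [not_nonempty_iff_eq_empty] at hne
    refine hf (hT.free (fun e he heB => ?_) (fun b hb => ?_) hN (by omega) (by omega))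
    · exact notMem_empty e (hne ▸ mem_inter.2 ⟨heB, he⟩)
    · rwa [show b = N by omega]

theorem degB_vert [NeZero n] {B : Finset (Sym2 (ZMod n))} (hB : ∀ e ∈ B, IsEdge n e) {w : ℕ}
    (hw : w < n) : degB n B (vert n o w) = pairDeg (edgePairs n o B) w := by
  rw [degB, pairDeg]
  conv_lhs => rw [← image_edgePairs (o := o) hB]
  rw [filter_image,
    card_image_of_injOn (injOn_edgePairs.mono (coe_subset.2 (filter_subset _ _)))]
  congr 1
  ext ⟨a, b⟩
  simp only [mem_filter]
  refine and_congr_right fun h => ?_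
  obtain ⟨hab, hb, -⟩ := mem_edgePairs.1 h
  rw [Sym2.mem_iff, vert_inj hw (by omega), vert_inj hw hb]
  simp only [eq_comm]

end Vert

theorem IsSaturatedBlocker.isDiagonal {n : ℕ} {B : Finset (Sym2 (ZMod n))}
    (hB : IsSaturatedBlocker n B) {e : Sym2 (ZMod n)} (he : e ∈ B) : IsDiagonal n e := by
  by_contra hd
  refine hB.2 e he ⟨fun e' he' => hB.1.1 e' (mem_of_mem_erase he'), fun T hT => ?_⟩
  obtain ⟨g, hg⟩ := hB.1.2 T hT
  obtain ⟨hgB, hgT⟩ := mem_inter.1 hg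
  refine ⟨g, mem_inter.2 ⟨mem_erase.2 ⟨?_, hgB⟩, hgT⟩⟩
  rintro rfl
  exact hd (hT.1 g hgT)

/-- A saturated blocker with `n - 1` edges and a vertex of degree one has an uncovered vertex of
degree two. -/
theorem IsSaturatedBlocker.exists_degB_eq_two {n : ℕ} (hn : 4 ≤ n) {B : Finset (Sym2 (ZMod n))}
    (hB : IsSaturatedBlocker n B) (hcard : #B = n - 1) {v : ZMod n} (hv : degB n B v = 1) :
    ∃ w : ZMod n, s(w - 1, w + 1) ∉ B ∧ degB n B w = 2 := by
  by_contra! hno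
  have : NeZero n := ⟨by omega⟩
  obtain ⟨N, rfl⟩ : ∃ N, n = N + 1 := ⟨n - 1, by omega⟩
  have hN0 : (N : ZMod (N + 1)) + 1 = 0 := by exact_mod_cast ZMod.natCast_self (N + 1)
  have hvN : vert (N + 1) (v + 1) N = v := by
    linear_combination hN0
  have hdiag : ∀ a b, (a, b) ∈ edgePairs (N + 1) (v + 1) B →
      a + 2 ≤ b ∧ b ≤ N ∧ ¬ (a = 0 ∧ b = N) := by
    intro a b h
    obtain ⟨hab, hb, hm⟩ := mem_edgePairs.1 h
    have := (isDiagonal_vert_iff hab hb).1 (hB.isDiagonal hm)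
    omega
  have hroot : s(vert (N + 1) (v + 1) 0, vert (N + 1) (v + 1) N) ∉ B := by
    intro h
    have := hdiag 0 N (mem_edgePairs.2 ⟨by omega, by omega, h⟩)
    omega
  have hpd : pairDeg (edgePairs (N + 1) (v + 1) B) N = 1 := by
    rw [← degB_vert hB.1.1 (by omega), hvN, hv]
  obtain ⟨⟨X, N'⟩, hX⟩ := card_eq_one.1 hpd
  have hXmem : (X, N') ∈ edgePairs (N + 1) (v + 1) B ∧ (X = N ∨ N' = N) :=
    mem_filter.1 (hX ▸ mem_singleton_self _)
  have hXd := hdiag X N' hXmem.1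
  obtain rfl : N' = N := by omega
  refine pendant_contradiction (W := edgePairs (N' + 1) (v + 1) B) (N := N') (X := X)
    (fun a b h => ⟨(hdiag a b h).1, (hdiag a b h).2.1⟩) (by omega) hXd.1 hXmem.1 ?_ ?_ ?_ ?_ ?_ ?_
  · intro c hc
    have : (c, N') ∈ ({(X, N')} : Finset (ℕ × ℕ)) := hX ▸ mem_filter.2 ⟨hc, Or.inr rfl⟩
    simpa using this
  · exact (forall_triangulation_inter_nonempty_iff rfl (by omega) hroot).1 hB.1.2
  · rintro ⟨a, b⟩ he
    obtain ⟨hab, hb, hm⟩ := mem_edgePairs.1 he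
    rw [← edgePairs_erase hab hb]
    by_contra hf
    refine hB.2 _ hm ⟨fun e he => hB.1.1 e (mem_of_mem_erase he), ?_⟩
    exact (forall_triangulation_inter_nonempty_iff rfl (by omega)
      fun h => hroot (mem_of_mem_erase h)).2 hf
  · rw [← card_image_of_injOn (injOn_edgePairs (o := v + 1) (B := B)), image_edgePairs hB.1.1, hcard]
    omega
  · intro w hw hwN hcov
    rw [← degB_vert hB.1.1 (by omega)]
    refine hno _ fun hm => hcov (mem_edgePairs.2 ⟨by omega, by omega, ?_⟩)
    convert hm using 2
    · push_cast [vert, Nat.cast_sub hw]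
      ring
    · push_cast [vert]
      ring
  · intro hX1
    rw [← degB_vert (o := v + 1) hB.1.1 (by omega)]
    refine hno _ fun hm => hX1 ?_
    have h1 : (1, N') ∈ edgePairs (N' + 1) (v + 1) B := by
      refine mem_edgePairs.2 ⟨by omega, by omega, ?_⟩
      rw [Sym2.eq_swap, hvN]
      convert hm using 2 <;> simp [vert]
    have : (1, N') ∈ ({(X, N')} : Finset (ℕ × ℕ)) := hX ▸ mem_filter.2 ⟨h1, Or.inr rfl⟩
    simp only [mem_singleton, Prod.mk.injEq, and_true] at this
    exact this.symm

end ConvexBlocker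

open ConvexBlocker in
/-- if a saturated blocker `B'` of size `n-1` (`n > 6`) has no non-covered
vertex of degree `2`, and `v` is a non-covered vertex of degree `1`, then `B'∖{v}` is a
saturated blocker with exactly `n-2` edges of the `(n-1)`-gon `C∖{v}`. -/
theorem deleted_pendant_vertex_gives_saturated_blocker
    (n : ℕ) (hn : 6 < n) (B' : Finset (Sym2 (ZMod n)))
    (hB : IsSaturatedBlocker n B') (hcard : B'.card = n - 1)
    (hno : ∀ w : ZMod n, s(w - 1, w + 1) ∉ B' → degB n B' w ≠ 2)
    (v : ZMod n) (hv1 : degB n B' v = 1) (hv2 : s(v - 1, v + 1) ∉ B') :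
    IsSaturatedBlockerOn n (((Finset.range n).image (fun j : ℕ => (j : ZMod n))).erase v)
        ((B'.filter (fun e => v ∉ e)).erase s(v - 1, v + 1)) ∧
      ((B'.filter (fun e => v ∉ e)).erase s(v - 1, v + 1)).card = n - 2 := by
  obtain ⟨w, hw, hdeg⟩ := hB.exists_degB_eq_two (by omega) hcard hv1
  exact absurd hdeg (hno w hw)
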